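/- Define S on the Connes–Kreimer Hopf algebra H_K as the algebra homomorphism determined on rooted trees by S(t) = −Σ_{all cuts c of t} (−1)^{|c|} P^c(t)·R^c(t), where the sum is over all cuts (not only admissible ones) and the empty cut contributes −t. Then S is the antipode of H_K: for every rooted tree t, S(t) + t + Σ_{nonempty admissible cuts c of t} S(P^c(t))·R^c(t) = 0, i.e., μ∘(S⊗id)∘Δ(t) = 0, where S acts multiplicatively on the forest P^c(t). -/

import Mathlib

/-! ### Planar rooted trees -/

/-- A planar rooted tree: a root with an ordered list of branches.
`PTree.node [T₁,…,T_k]` is `B₊(T₁⋯T_k)`; `PTree.node []` is the one-vertex tree `•`. -/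
inductive PTree : Type where
  | node : List PTree → PTree

instance : Inhabited PTree := ⟨.node []⟩

noncomputable instance : DecidableEq PTree := Classical.decEq _

/-- Number of vertices of a planar rooted tree. -/
def PTree.size : PTree → ℕ
  | .node l => 1 + (l.attach.map (fun x => PTree.size x.1)).sum
decreasing_by
  have h := List.sizeOf_lt_of_mem x.2
  simp only [PTree.node.sizeOf_spec]
  omega

/-! ### Rooted trees -/

/-- Isomorphism of the underlying rooted trees: the lists of branches agree
up to permutation and recursive isomorphism. -/
inductive PTree.Equiv : PTree → PTree → Prop where
  | node {l m m' : List PTree} :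
      List.Forall₂ PTree.Equiv l m' → List.Perm m' m → PTree.Equiv (.node l) (.node m)

/-- Rooted trees: planar rooted trees modulo isomorphism. -/
def RTree : Type := Quot PTree.Equiv

/-- The underlying rooted tree of a planar rooted tree. -/
def toR : PTree → RTree := Quot.mk _

/-- A choice of planar representative of a rooted tree. -/
noncomputable def RTree.out : RTree → PTree := Quot.out

noncomputable instance : DecidableEq RTree := Classical.decEq _

/-- The order of the symmetry group of (the underlying rooted tree of) a planar
rooted tree: `|Sym(B₊(t₁⋯t_k))| = (∏_s m_s!)·∏ᵢ |Sym(tᵢ)|`, where `m_s` is the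
multiplicity of the isomorphism type `s` among the branches `t₁,…,t_k`. -/
noncomputable def PTree.symOrder : PTree → ℕ
  | .node l =>
      (l.attach.map (fun x => PTree.symOrder x.1)).prod *
      (((l.map toR : List RTree) : Multiset RTree).toFinset.prod
        (fun s => (Multiset.count s (l.map toR : Multiset RTree)).factorial))
decreasing_by
  have h := List.sizeOf_lt_of_mem x.2
  simp only [PTree.node.sizeOf_spec]
  omega

/-- The order of the symmetry group of a rooted tree. -/
noncomputable def RTree.sym (t : RTree) : ℕ := t.out.symOrder

/-- Number of vertices of a rooted tree. -/
noncomputable def RTree.size (t : RTree) : ℕ := t.out.size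

/-- `B₊` for rooted trees: attach a new root to a multiset forest. -/
noncomputable def RTree.node (m : Multiset RTree) : RTree :=
  toR (PTree.node (m.toList.map RTree.out))

/-- The one-vertex rooted tree `•`. -/
noncomputable def RTree.bullet : RTree := toR (.node [])

/-! ### Cuts -/

/-- A decoration of (the edges of) a tree by Booleans: `true` means the edge
belongs to the cut. `Cut.node [(b₁,c₁),…,(b_k,c_k)]` matches a tree
`PTree.node [t₁,…,t_k]`, with `bᵢ` decorating the edge from the root to `tᵢ`
and `cᵢ` a cut of `tᵢ`. -/
inductive Cut : Type where
  | node : List (Bool × Cut) → Cut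

namespace Cut

mutual
/-- The number of edges in a cut. -/
def size : Cut → ℕ
  | .node l => sizeList l
/-- The number of edges in a list of decorated edges. -/
def sizeList : List (Bool × Cut) → ℕ
  | [] => 0
  | (b, c) :: cs => (if b then 1 else 0) + size c + sizeList cs
end

mutual
/-- The cut containing no edges. -/
def isEmpty : Cut → Bool
  | .node l => isEmptyList l
/-- Whether a list of decorated edges contains no cut edge. -/
def isEmptyList : List (Bool × Cut) → Bool
  | [] => true
  | (b, c) :: cs => !b && isEmpty c && isEmptyList cs
end

mutual
/-- A cut is admissible if every path from the root to a leaf meets it at most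
once, i.e. below a cut edge there is no further cut edge. -/
def admissible : Cut → Bool
  | .node l => admissibleList l
/-- Admissibility for a list of decorated edges. -/
def admissibleList : List (Bool × Cut) → Bool
  | [] => true
  | (b, c) :: cs => (if b then isEmpty c else admissible c) && admissibleList cs
end

end Cut

namespace PTree

mutual
/-- All cuts (edge subsets) of a planar rooted tree. -/
def cutsOf : PTree → List Cut
  | .node l => (cutsOfList l).map Cut.node
/-- All decorations of a forest. -/
def cutsOfList : List PTree → List (List (Bool × Cut))
  | [] => [[]]
  | t :: ts =>
      (cutsOf t).flatMap (fun c =>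
        (cutsOfList ts).flatMap (fun cs => [(true, c) :: cs, (false, c) :: cs]))
end

mutual
/-- `cutPieces t c = (R^c(t), P^c(t))`: the root component of `t` after removing
the edges of `c`, together with the ordered forest of the remaining components
(in planar depth-first order). -/
def cutPieces : PTree → Cut → PTree × List PTree
  | .node l, .node cs =>
      ((PTree.node (cutPiecesList l cs).1 : PTree), (cutPiecesList l cs).2)
/-- `cutPieces` for forests. -/
def cutPiecesList : List PTree → List (Bool × Cut) → List PTree × List PTree
  | [], _ => ([], [])
  | _ :: _, [] => ([], [])
  | t :: ts, (b, c) :: cs =>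
      let p := cutPieces t c
      let q := cutPiecesList ts cs
      if b then (q.1, (p.1 :: p.2) ++ q.2) else (p.1 :: q.1, p.2 ++ q.2)
end

/-- `R^c(T)`, the component containing the root. -/
def Rcut (t : PTree) (c : Cut) : PTree := (cutPieces t c).1

/-- `P^c(T)`, the ordered forest of components not containing the root. -/
def Pcut (t : PTree) (c : Cut) : List PTree := (cutPieces t c).2

end PTree

/-- `R^c` for rooted trees. -/
noncomputable def RcutR (t : RTree) (c : Cut) : RTree := toR (t.out.Rcut c)

/-- `P^c` for rooted trees: a multiset forest. -/
noncomputable def PcutR (t : RTree) (c : Cut) : Multiset RTree :=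
  ((t.out.Pcut c).map toR : List RTree)

/-! ### The Connes–Kreimer Hopf algebra -/

/-- The Connes–Kreimer Hopf algebra over `k`: the free commutative algebra on
rooted trees, with monomial basis the forests (multisets) of rooted trees. -/
abbrev HK (k : Type*) [CommSemiring k] := AddMonoidAlgebra k (Multiset RTree)

/-- The model for `H_K ⊗ H_K`: monomial basis consists of pairs of forests. -/
abbrev HK2 (k : Type*) [CommSemiring k] :=
  AddMonoidAlgebra k (Multiset RTree × Multiset RTree)

/-- The map `S` on trees: `S(t) = −Σ_{all cuts c of t} (−1)^{|c|} P^c(t)·R^c(t)`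
(the sum being over all cuts, not only admissible ones; the empty cut
contributes `−t`). -/
noncomputable def ckS (k : Type*) [CommRing k] (t : RTree) : HK k :=
  - (((PTree.cutsOf t.out).map (fun c =>
      ((-1 : k) ^ (Cut.size c)) •
        AddMonoidAlgebra.single (PcutR t c + ({RcutR t c} : Multiset RTree)) (1 : k))).sum)

/-- Multiplicative extension of `S` to forests. -/
noncomputable def ckSForest (k : Type*) [CommRing k] (w : Multiset RTree) : HK k :=
  (w.map (ckS k)).prod

/-! ### Grafting on rooted trees -/

mutual
theorem PTree.Equiv.refl : ∀ t : PTree, PTree.Equiv t t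
  | .node l => .node (PTree.Equiv.forall₂_refl l) (List.Perm.refl l)
theorem PTree.Equiv.forall₂_refl : ∀ l : List PTree, List.Forall₂ PTree.Equiv l l
  | [] => .nil
  | t :: ts => .cons (PTree.Equiv.refl t) (PTree.Equiv.forall₂_refl ts)
end

theorem toR_out (t : RTree) : toR t.out = t := Quot.out_eq t

theorem toR_node_perm {l l' : List PTree} (h : l.Perm l') :
    toR (.node l) = toR (.node l') :=
  Quot.sound (.node (PTree.Equiv.forall₂_refl l) h)

theorem toR_node_cons_congr {a b : PTree} (h : toR a = toR b) (l : List PTree) :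
    toR (.node (a :: l)) = toR (.node (b :: l)) :=
  congrArg (Quot.lift (fun x => toR (.node (x :: l))) fun _ _ hxy =>
    Quot.sound (.node (.cons hxy (PTree.Equiv.forall₂_refl l)) (List.Perm.refl _))) h

theorem toR_node_append_congr : ∀ {l l' : List PTree} (r : List PTree),
    l.map toR = l'.map toR → toR (.node (l ++ r)) = toR (.node (l' ++ r))
  | [], [], _, _ => rfl
  | [], _ :: _, _, h => by simp at h
  | _ :: _, [], _, h => by simp at h
  | a :: l, b :: l', r, h => by
    rw [List.map_cons, List.map_cons, List.cons.injEq] at h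
    calc toR (.node (a :: (l ++ r))) = toR (.node (b :: (l ++ r))) :=
          toR_node_cons_congr h.1 _
      _ = toR (.node (l ++ b :: r)) := toR_node_perm List.perm_middle.symm
      _ = toR (.node (l' ++ b :: r)) := toR_node_append_congr (b :: r) h.2
      _ = toR (.node (b :: (l' ++ r))) := toR_node_perm List.perm_middle

/-- `B₊` is computed on planar representatives. -/
theorem RTree.node_map_toR (l : List PTree) :
    RTree.node (l.map toR : List RTree) = toR (.node l) := by
  have hp : ((l.map toR : Multiset RTree).toList).Perm (l.map toR) :=
    Multiset.coe_eq_coe.mp (Multiset.coe_toList _)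
  have h := toR_node_append_congr (l := (l.map toR).map RTree.out) (l' := l) []
    (by simp [Function.comp_def, toR_out])
  rw [List.append_nil, List.append_nil] at h
  exact (toR_node_perm (hp.map _)).trans h

/-! ### Empty cuts -/

mutual
theorem Cut.admissible_of_isEmpty : ∀ c : Cut, c.isEmpty = true → c.admissible = true
  | .node l => fun h => by
    rw [Cut.isEmpty] at h
    rw [Cut.admissible]
    exact Cut.admissibleList_of_isEmptyList l h
theorem Cut.admissibleList_of_isEmptyList :
    ∀ l : List (Bool × Cut), Cut.isEmptyList l = true → Cut.admissibleList l = true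
  | [] => fun _ => rfl
  | (b, c) :: cs => fun h => by
    simp only [Cut.isEmptyList, Bool.and_eq_true, Bool.not_eq_true'] at h
    simp [Cut.admissibleList, h.1.1, Cut.admissible_of_isEmpty c h.1.2,
      Cut.admissibleList_of_isEmptyList cs h.2]
end

theorem List.sum_map_filter_add_sum_map_ite {α A : Type*} [AddCommMonoid A] {p q : α → Bool}
    (h : ∀ a, q a = true → p a = true) (f : α → A) (l : List α) :
    ((l.filter fun a => p a && !q a).map f).sum + (l.map fun a => if q a then f a else 0).sum
      = (l.map fun a => if p a then f a else 0).sum := by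
  induction l with
  | nil => simp
  | cons a l ih =>
    have ha := h a
    rw [List.map_cons, List.map_cons, List.sum_cons, List.sum_cons, ← ih, List.filter_cons]
    cases hq : q a <;> cases hp : p a <;> simp_all [add_assoc, add_left_comm]

theorem PTree.sum_cutsOf_node {A : Type*} [AddCommMonoid A] (l : List PTree) (f : Cut → A) :
    ((cutsOf (.node l)).map f).sum = ((cutsOfList l).map fun cs => f (.node cs)).sum := by
  rw [cutsOf, List.map_map]; rfl

theorem PTree.sum_cutsOfList_cons {A : Type*} [AddCommMonoid A] (t : PTree) (ts : List PTree)
    (f : List (Bool × Cut) → A) :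
    ((cutsOfList (t :: ts)).map f).sum
      = ((cutsOf t).map fun c =>
          ((cutsOfList ts).map fun cs => f ((true, c) :: cs) + f ((false, c) :: cs)).sum).sum := by
  rw [cutsOfList]
  simp [List.flatMap_def, List.sum_flatten, List.map_flatten, Function.comp_def]

mutual
theorem PTree.sum_isEmpty {A : Type*} [AddCommMonoid A] : ∀ (t : PTree)
    (f : PTree × List PTree → A),
    ((cutsOf t).map fun c => if c.isEmpty then f (cutPieces t c) else 0).sum = f (t, [])
  | .node l => fun f => by
    rw [PTree.sum_cutsOf_node]
    simp only [Cut.isEmpty, cutPieces]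
    exact PTree.sum_isEmptyList l fun q => f (.node q.1, q.2)
theorem PTree.sum_isEmptyList {A : Type*} [AddCommMonoid A] : ∀ (l : List PTree)
    (f : List PTree × List PTree → A),
    ((cutsOfList l).map fun cs =>
      if Cut.isEmptyList cs then f (cutPiecesList l cs) else 0).sum = f (l, [])
  | [] => fun f => by simp [cutsOfList, Cut.isEmptyList, cutPiecesList]
  | t :: ts => fun f => by
    rw [PTree.sum_cutsOfList_cons]
    have h (c : Cut) : ((cutsOfList ts).map fun cs =>
        (if Cut.isEmptyList ((true, c) :: cs) then
          f (cutPiecesList (t :: ts) ((true, c) :: cs)) else 0)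
        + (if Cut.isEmptyList ((false, c) :: cs) then
          f (cutPiecesList (t :: ts) ((false, c) :: cs)) else 0)).sum
        = if c.isEmpty then f ((cutPieces t c).1 :: ts, (cutPieces t c).2 ++ []) else 0 := by
      cases hc : c.isEmpty
      · simp [Cut.isEmptyList, hc]
      · simpa [Cut.isEmptyList, hc, cutPiecesList] using PTree.sum_isEmptyList ts fun q =>
          f ((cutPieces t c).1 :: q.1, (cutPieces t c).2 ++ q.2)
    simp only [h]
    exact PTree.sum_isEmpty t fun p => f (p.1 :: ts, p.2 ++ [])
end

/-! ### Generating sums over cuts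

Sums over cuts are recorded in the algebra of forests with coefficients in `H_K`: the monomial
carries the root component, the coefficient carries the pruned forest. -/

section CutSums

open AddMonoidAlgebra

variable (k : Type*) [CommRing k]

/-- Grafting of the monomial forest, linearly extended. -/
noncomputable def graft : AddMonoidAlgebra (HK k) (Multiset RTree) →+
    AddMonoidAlgebra (HK k) (Multiset RTree) where
  toFun := mapDomain fun w => {RTree.node w}
  map_zero' := mapDomain_zero _
  map_add' := mapDomain_add _

/-- Multiplication of the coefficient with the monomial forest. -/
noncomputable def mergeForests : AddMonoidAlgebra (HK k) (Multiset RTree) →+ HK k :=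
  liftNC (AddMonoidHom.id _) fun w => single w.toAdd 1

theorem graft_single (w : Multiset RTree) (a : HK k) :
    graft k (single w a) = single {RTree.node w} a := mapDomain_single

theorem mergeForests_single (w : Multiset RTree) (a : HK k) :
    mergeForests k (single w a) = a * single w 1 := liftNC_single _ _ _ _

/-- The forest of rooted trees underlying a list of planar rooted trees. -/
def forestR (l : List PTree) : Multiset RTree := (l.map toR : List RTree)

theorem forestR_cons (t : PTree) (l : List PTree) :
    forestR (t :: l) = {toR t} + forestR l := rfl

theorem forestR_append (l l' : List PTree) : forestR (l ++ l') = forestR l + forestR l' := by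
  simp [forestR]

/-- The signed sum over all cuts of a planar rooted tree. -/
noncomputable def allCutSum (t : PTree) : AddMonoidAlgebra (HK k) (Multiset RTree) :=
  ((PTree.cutsOf t).map fun c =>
    single {toR (PTree.cutPieces t c).1}
      ((-1 : k) ^ c.size • (single (forestR (PTree.cutPieces t c).2) 1 : HK k))).sum

/-- The signed sum over all cuts of the edges joining a root to, or lying in, a planar forest. -/
noncomputable def allCutSumList (l : List PTree) : AddMonoidAlgebra (HK k) (Multiset RTree) :=
  ((PTree.cutsOfList l).map fun cs =>
    single (forestR (PTree.cutPiecesList l cs).1)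
      ((-1 : k) ^ Cut.sizeList cs •
        (single (forestR (PTree.cutPiecesList l cs).2) 1 : HK k))).sum

/-- The planar version of `ckS`. -/
noncomputable def planarS (t : PTree) : HK k := -mergeForests k (allCutSum k t)

/-- The sum over admissible cuts of `S(P^c)` and `R^c`. -/
noncomputable def admCutSum (t : PTree) : AddMonoidAlgebra (HK k) (Multiset RTree) :=
  ((PTree.cutsOf t).map fun c => if c.admissible then
    single {toR (PTree.cutPieces t c).1}
      (((PTree.cutPieces t c).2.map (planarS k)).prod : HK k) else 0).sum

/-- The version of `admCutSum` for the forest of branches at a root. -/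
noncomputable def admCutSumList (l : List PTree) : AddMonoidAlgebra (HK k) (Multiset RTree) :=
  ((PTree.cutsOfList l).map fun cs => if Cut.admissibleList cs then
    single (forestR (PTree.cutPiecesList l cs).1)
      (((PTree.cutPiecesList l cs).2.map (planarS k)).prod : HK k) else 0).sum

theorem allCutSum_node (l : List PTree) :
    allCutSum k (.node l) = graft k (allCutSumList k l) := by
  rw [allCutSum, PTree.sum_cutsOf_node]
  simp only [allCutSumList, map_list_sum, List.map_map, Function.comp_def,
    PTree.cutPieces, Cut.size, graft_single, forestR, RTree.node_map_toR]

theorem admCutSum_node (l : List PTree) :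
    admCutSum k (.node l) = graft k (admCutSumList k l) := by
  rw [admCutSum, PTree.sum_cutsOf_node]
  simp only [admCutSumList, map_list_sum, List.map_map, Function.comp_def,
    PTree.cutPieces, Cut.admissible, apply_ite (graft k), map_zero, graft_single,
    forestR, RTree.node_map_toR]
  rfl

theorem planarS_eq_sum (t : PTree) :
    planarS k t = -((PTree.cutsOf t).map fun c => (-1 : k) ^ c.size •
      (single (forestR (PTree.cutPieces t c).2 + {toR (PTree.cutPieces t c).1}) 1 : HK k)).sum := by
  simp only [planarS, allCutSum, map_list_sum, List.map_map, Function.comp_def,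
    mergeForests_single, smul_mul_assoc, single_mul_single, one_mul]

theorem allCutSumList_nil : allCutSumList k [] = 1 := by
  simp [allCutSumList, PTree.cutsOfList, PTree.cutPiecesList, Cut.sizeList, forestR, one_def]

theorem admCutSumList_nil : admCutSumList k [] = 1 := by
  simp [admCutSumList, PTree.cutsOfList, PTree.cutPiecesList, Cut.admissibleList, forestR, one_def]

theorem single_zero_planarS (t : PTree) :
    (single 0 (planarS k t) : AddMonoidAlgebra (HK k) (Multiset RTree)) =
      ((PTree.cutsOf t).map fun c => single 0 (-((-1 : k) ^ c.size •
        (single (forestR (PTree.cutPieces t c).2 + {toR (PTree.cutPieces t c).1}) 1 :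
          HK k)))).sum := by
  rw [planarS_eq_sum, ← singleAddHom_apply, ← neg_one_mul, ← List.sum_map_mul_left,
    map_list_sum, List.map_map]
  simp only [Function.comp_def, neg_one_mul, singleAddHom_apply]

theorem allCutSumList_cons (t : PTree) (ts : List PTree) :
    allCutSumList k (t :: ts) =
      (allCutSum k t + single 0 (planarS k t)) * allCutSumList k ts := by
  rw [single_zero_planarS]
  simp only [allCutSum, allCutSumList, PTree.sum_cutsOfList_cons, ← List.sum_map_add,
    ← List.sum_map_mul_right]
  simp only [← List.sum_map_mul_left]
  congr 2; funext c
  congr 2; funext cs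
  simp only [PTree.cutPiecesList, Cut.sizeList, if_true, Bool.false_eq_true, if_false,
    add_mul, single_mul_single, forestR_cons, forestR_append, zero_add,
    smul_mul_smul_comm, one_mul, neg_mul, pow_add, pow_one, neg_smul, List.cons_append]
  rw [add_comm]
  congr 4; rw [add_left_comm, add_assoc]

theorem admCutSumList_cons (t : PTree) (ts : List PTree) :
    admCutSumList k (t :: ts) =
      (admCutSum k t + single 0 (planarS k t)) * admCutSumList k ts := by
  have h := PTree.sum_isEmpty t fun p => (single 0 (((p.1 :: p.2).map (planarS k)).prod : HK k) :
    AddMonoidAlgebra (HK k) (Multiset RTree))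
  simp only [List.map_cons, List.map_nil, List.prod_cons, List.prod_nil, mul_one] at h
  rw [← h]
  simp only [admCutSum, admCutSumList, PTree.sum_cutsOfList_cons, ← List.sum_map_add,
    ← List.sum_map_mul_right]
  simp only [← List.sum_map_mul_left]
  congr 2; funext c
  congr 2; funext cs
  simp only [PTree.cutPiecesList, Cut.admissibleList, if_true, Bool.false_eq_true, if_false]
  cases c.isEmpty <;> cases c.admissible <;> cases Cut.admissibleList cs <;>
    simp [add_mul, single_mul_single, forestR_cons, add_comm, mul_assoc]

theorem allCutSumList_eq_prod (l : List PTree) :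
    allCutSumList k l = (l.map fun t => allCutSum k t + single 0 (planarS k t)).prod := by
  induction l with
  | nil => exact allCutSumList_nil k
  | cons t ts ih => rw [allCutSumList_cons, ih, List.map_cons, List.prod_cons]

mutual
/-- Pruning by admissible cuts and then applying `S` yields the signed sum over all cuts. -/
theorem admCutSum_eq : ∀ t : PTree, admCutSum k t = allCutSum k t
  | .node l => by rw [admCutSum_node, allCutSum_node, admCutSumList_eq l]
theorem admCutSumList_eq : ∀ l : List PTree, admCutSumList k l = allCutSumList k l
  | [] => by rw [admCutSumList_nil, allCutSumList_nil]
  | t :: ts => by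
    rw [admCutSumList_cons, allCutSumList_cons, admCutSum_eq t, admCutSumList_eq ts]
end

/-- The signed sum over all cuts depends only on the underlying rooted tree. -/
theorem allCutSum_congr {t t' : PTree} (h : PTree.Equiv t t') :
    allCutSum k t = allCutSum k t' := by
  induction h using PTree.Equiv.rec (motive_2 := fun l l' _ =>
    l.map (allCutSum k) = l'.map (allCutSum k)) with
  | node _ hp ih =>
    have key (l : List PTree) : allCutSumList k l =
        ((l.map (allCutSum k)).map fun x => x + single 0 (-mergeForests k x)).prod := by
      rw [allCutSumList_eq_prod, List.map_map]; rfl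
    rw [allCutSum_node, allCutSum_node, key, key, ih, ((hp.map _).map _).prod_eq]
  | nil => rfl
  | cons _ _ h₁ h₂ => rw [List.map_cons, List.map_cons, h₁, h₂]

theorem allCutSum_out (t : PTree) : allCutSum k (toR t).out = allCutSum k t :=
  congrArg (Quot.lift (allCutSum k) fun _ _ h => allCutSum_congr k h) (toR_out (toR t))

theorem ckS_eq_planarS (t : RTree) : ckS k t = planarS k t.out := by
  rw [planarS_eq_sum]; rfl

theorem ckS_toR (t : PTree) : ckS k (toR t) = planarS k t := by
  rw [ckS_eq_planarS, planarS, planarS, allCutSum_out]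

theorem ckSForest_forestR (l : List PTree) :
    ckSForest k (forestR l) = (l.map (planarS k)).prod := by
  simp [ckSForest, forestR, Function.comp_def, ckS_toR]

end CutSums

/-- The explicit cut formula
`S(t) = −Σ_{all cuts c} (−1)^{|c|} P^c(t)·R^c(t)` gives the antipode of the
Connes–Kreimer Hopf algebra: for every rooted tree `t`,
`S(t) + t + Σ_{nonempty admissible cuts c} S(P^c(t))·R^c(t) = 0`,
i.e. `μ∘(S ⊗ id)∘Δ(t) = 0`. -/
theorem ckS_antipode_identity (k : Type*) [Field k] [CharZero k] (t : RTree) :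
    ckS k t + AddMonoidAlgebra.single ({t} : Multiset RTree) (1 : k)
      + (((PTree.cutsOf t.out).filter
            (fun c => Cut.admissible c && !(Cut.isEmpty c))).map
          (fun c => ckSForest k (PcutR t c)
            * AddMonoidAlgebra.single ({RcutR t c} : Multiset RTree) (1 : k))).sum
      = 0 := by
  let f (p : PTree × List PTree) : HK k :=
    ckSForest k (forestR p.2) * AddMonoidAlgebra.single {toR p.1} 1
  have hfilter : (((PTree.cutsOf t.out).filter
      (fun c => Cut.admissible c && !(Cut.isEmpty c))).map
        (fun c => f (PTree.cutPieces t.out c))).sum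
      + ((PTree.cutsOf t.out).map fun c =>
          if c.isEmpty then f (PTree.cutPieces t.out c) else 0).sum
      = ((PTree.cutsOf t.out).map fun c =>
          if c.admissible then f (PTree.cutPieces t.out c) else 0).sum :=
    List.sum_map_filter_add_sum_map_ite Cut.admissible_of_isEmpty _ _
  have hadm : ((PTree.cutsOf t.out).map fun c =>
      if c.admissible then f (PTree.cutPieces t.out c) else 0).sum
      = mergeForests k (admCutSum k t.out) := by
    simp only [f, admCutSum, map_list_sum, List.map_map, Function.comp_def,
      apply_ite (mergeForests k), map_zero, mergeForests_single, ckSForest_forestR]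
  rw [PTree.sum_isEmpty, hadm, admCutSum_eq] at hfilter
  have hempty : f (t.out, []) = AddMonoidAlgebra.single {t} 1 := by
    simp [f, toR_out, ckSForest, forestR]
  rw [hempty] at hfilter
  have hS : ckS k t = -mergeForests k (allCutSum k t.out) := ckS_eq_planarS k t
  rw [add_assoc, add_comm (AddMonoidAlgebra.single _ _), hS]
  exact neg_add_eq_zero.mpr hfilter.symm
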